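/- Let q be a prime power and let K be a finite field with exactly q² elements. Then the number of pairs (x, y) ∈ K × K satisfying y^{q+1} = x^q + x equals q³. (This is the point-count form of the F_{q²}-maximality of the Hermitian function field K(x,y) with y^{q+1} = x^q + x.) -/

import Mathlib

/-- The equation `x ^ q = c * x` has at most `q` solutions in a field. -/
theorem ncard_pow_eq_mul_le {K : Type*} [Field K] {q : ℕ} (hq : 1 < q) (c : K) :
    {x : K | x ^ q = c * x}.ncard ≤ q := by
  classical
  have hlt : (Polynomial.C c * Polynomial.X : Polynomial K).degree <
      (Polynomial.X ^ q : Polynomial K).degree := by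
    rw [Polynomial.degree_X_pow]
    exact (Polynomial.degree_C_mul_X_le c).trans_lt (by exact_mod_cast hq)
  have hdeg : (Polynomial.X ^ q - Polynomial.C c * Polynomial.X : Polynomial K).degree = q := by
    rw [Polynomial.degree_sub_eq_left_of_degree_lt hlt, Polynomial.degree_X_pow]
  set P : Polynomial K := Polynomial.X ^ q - Polynomial.C c * Polynomial.X with hP
  have hP0 : P ≠ 0 := by
    intro h
    simp [h] at hdeg
  have hsub : {x : K | x ^ q = c * x} ⊆ (P.roots.toFinset : Set K) := by
    intro x hx
    have hx' : x ^ q = c * x := hx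
    rw [Finset.mem_coe, Multiset.mem_toFinset, Polynomial.mem_roots hP0]
    simp [hP, hx']
  calc {x : K | x ^ q = c * x}.ncard ≤ (P.roots.toFinset : Set K).ncard :=
        Set.ncard_le_ncard hsub (Finset.finite_toSet _)
    _ = P.roots.toFinset.card := Set.ncard_coe_finset _
    _ ≤ P.roots.card := Multiset.toFinset_card_le _
    _ ≤ P.natDegree := P.card_roots'
    _ = q := Polynomial.natDegree_eq_of_degree_eq_some hdeg

/-- In a field with `q ^ 2` elements, raising to the power `q` is additive. -/
theorem add_pow_of_card_eq_sq {q : ℕ} (hq : IsPrimePow q) {K : Type*} [Field K] [Fintype K]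
    (hK : Fintype.card K = q ^ 2) (x y : K) : (x + y) ^ q = x ^ q + y ^ q := by
  obtain ⟨p, n, hp, hn, rfl⟩ := hq
  have hp' : p.Prime := hp.nat_prime
  have : Fact p.Prime := ⟨hp'⟩
  have hp0 : (p : K) = 0 := by
    have h := FiniteField.cast_card_eq_zero K
    rw [hK] at h
    push_cast at h
    exact eq_zero_of_pow_eq_zero (eq_zero_of_pow_eq_zero h)
  have : CharP K p := (CharP.charP_iff_prime_eq_zero hp').2 hp0
  exact add_pow_char_pow x y p n

/-- The relative trace `x ↦ x ^ q + x` of a field with `q ^ 2` elements has a kernel of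
cardinality `q`, and its range is the set of fixed points of `x ↦ x ^ q`. -/
theorem card_ker_and_mem_range_of_card_eq_sq {q : ℕ} (hq : IsPrimePow q) {K : Type*} [Field K]
    [Fintype K] (hK : Fintype.card K = q ^ 2) (T : K →+ K) (hT : ∀ x, T x = x ^ q + x) :
    Nat.card T.ker = q ∧ ∀ z : K, z ^ q = z → z ∈ T.range := by
  have hpow : ∀ x : K, (x ^ q) ^ q = x := fun x ↦ by
    rw [← pow_mul, ← sq, ← hK, FiniteField.pow_card]
  have hker : Nat.card T.ker ≤ q := by
    refine le_trans (le_of_eq ?_) (ncard_pow_eq_mul_le hq.one_lt (-1 : K))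
    rw [← Nat.card_coe_set_eq]
    congr! 3 with x
    simp [AddMonoidHom.mem_ker, hT, eq_neg_iff_add_eq_zero]
  have hS : {x : K | x ^ q = x}.ncard ≤ q := by
    simpa using ncard_pow_eq_mul_le hq.one_lt (1 : K)
  have hsub : (T.range : Set K) ⊆ {x : K | x ^ q = x} := by
    rintro _ ⟨x, rfl⟩
    simp only [Set.mem_ofPred_eq, hT]
    rw [add_pow_of_card_eq_sq hq hK, hpow, add_comm]
  have hrange : Nat.card T.range = (T.range : Set K).ncard := Nat.card_coe_set_eq _
  have hle : (T.range : Set K).ncard ≤ q := (Set.ncard_le_ncard hsub (Set.toFinite _)).trans hS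
  have hmul : Nat.card T.ker * (T.range : Set K).ncard = q * q := by
    rw [← hrange, ← AddSubgroup.index_ker, AddSubgroup.card_mul_index, Nat.card_eq_fintype_card,
      hK, sq]
  have hq0 : 0 < q := hq.pos
  have hk : Nat.card T.ker = q := by nlinarith
  have hr : (T.range : Set K).ncard = q := by nlinarith
  refine ⟨hk, fun z hz ↦ ?_⟩
  have heq := Set.eq_of_subset_of_ncard_le hsub (hS.trans hr.ge) (Set.toFinite _)
  have hz' : z ∈ (T.range : Set K) := heq ▸ hz
  exact hz'

/-- Point-count form of the maximality of the Hermitian function field: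
over a field with `q^2` elements the equation `y^{q+1} = x^q + x` has
exactly `q^3` solutions. -/
theorem stmt_11 (q : ℕ) (hq : IsPrimePow q)
    (K : Type*) [Field K] [Fintype K] (hK : Fintype.card K = q ^ 2) :
    Nat.card {p : K × K // p.2 ^ (q + 1) = p.1 ^ q + p.1} = q ^ 3 := by
  let T : K →+ K := AddMonoidHom.mk' (fun x ↦ x ^ q + x) fun x y ↦ by
    rw [add_pow_of_card_eq_sq hq hK]
    ring
  have hT : ∀ x, T x = x ^ q + x := fun _ ↦ rfl
  obtain ⟨hker, hrange⟩ := card_ker_and_mem_range_of_card_eq_sq hq hK T hT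
  have hnorm : ∀ y : K, ∃ x, T x = y ^ (q + 1) := fun y ↦ hrange _ <| by
    rw [← pow_mul, add_mul, ← sq, one_mul, pow_add, ← hK, FiniteField.pow_card, pow_succ']
  choose s hs using hnorm
  let e : {p : K × K // p.2 ^ (q + 1) = p.1 ^ q + p.1} ≃ K × T.ker :=
    { toFun := fun p ↦ (p.1.2, ⟨p.1.1 - s p.1.2, by
        rw [AddMonoidHom.mem_ker, map_sub, hs, hT, p.2, sub_self]⟩)
      invFun := fun r ↦ ⟨(r.2 + s r.1, r.1), by
        rw [← hT, map_add, hs, AddMonoidHom.mem_ker.1 r.2.2, zero_add]⟩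
      left_inv := fun p ↦ by simp
      right_inv := fun r ↦ by simp }
  rw [Nat.card_congr e, Nat.card_prod, hker, Nat.card_eq_fintype_card, hK]
  ring
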